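/- Let P and Q be probability distributions on {−1,1}^d and let h : {−1,1}^d → [−1,1]. For a ∈ {−1,1}^d, let P_a denote the pushforward of P under the coordinatewise product map x ↦ (a_1 x_1, …, a_d x_d), and similarly Q_a. Then E_{a∼Unif({−1,1}^d)}[(E_{x∼P_a}[h(x)] − E_{x∼Q_a}[h(x)])²] = Σ_{S⊆{1,…,d}} ĥ(S)² (P̂(S) − Q̂(S))². In particular, if |P̂(S) − Q̂(S)| ≤ θ for all S ⊆ {1,…,d}, then this expectation is at most θ². -/

import Mathlib

open MeasureTheory

/-- The Boolean cube `{-1,1}^d` inside `Fin d → ℝ`. -/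
def cube (d : ℕ) : Set (Fin d → ℝ) := {x | ∀ i, x i = 1 ∨ x i = -1}

/-- The Fourier coefficient `D̂(S) = E_{x∼D}[∏_{i∈S} x_i]` of a distribution on `{-1,1}^d`. -/
noncomputable def cubeFourier {d : ℕ} (D : Measure (Fin d → ℝ)) (S : Finset (Fin d)) : ℝ :=
  ∫ x, ∏ i ∈ S, x i ∂D

/-- The `±1` vector associated with a Boolean vector. -/
def sgnVec {d : ℕ} (b : Fin d → Bool) : Fin d → ℝ := fun i => if b i then 1 else -1

/-- The pushforward `P_a` of `P` under the coordinatewise product map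
`x ↦ (a₁x₁, …, a_dx_d)`. -/
noncomputable def flipped {d : ℕ} (P : Measure (Fin d → ℝ)) (a : Fin d → ℝ) :
    Measure (Fin d → ℝ) :=
  Measure.map (fun x i => a i * x i) P

/-- The Fourier coefficient `ĥ(S) = E_{x∼Unif({-1,1}^d)}[h(x) ∏_{i∈S} x_i]` of a function
on `{-1,1}^d`. -/
noncomputable def fnFourier {d : ℕ} (h : (Fin d → ℝ) → ℝ) (S : Finset (Fin d)) : ℝ :=
  (1 / 2 ^ d) * ∑ b : Fin d → Bool, h (sgnVec b) * ∏ i ∈ S, sgnVec b i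

theorem range_sgnVec (d : ℕ) : Set.range (sgnVec (d := d)) = cube d := by
  ext x
  constructor
  · rintro ⟨b, rfl⟩ i
    by_cases hb : b i <;> simp [sgnVec, hb]
  · intro hx
    refine ⟨fun i => decide (x i = 1), funext fun i => ?_⟩
    rcases hx i with hi | hi <;> norm_num [sgnVec, hi]

theorem sgnVec_mem_cube {d : ℕ} (b : Fin d → Bool) : sgnVec b ∈ cube d :=
  range_sgnVec d ▸ Set.mem_range_self b

theorem sgnVec_injective (d : ℕ) : Function.Injective (sgnVec (d := d)) := by
  intro a b hab
  funext i
  have hi := congrFun hab i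
  cases ha : a i <;> cases hb : b i <;> first | rfl | norm_num [sgnVec, ha, hb] at hi

theorem sgnVec_mul_self {d : ℕ} (b : Fin d → Bool) (i : Fin d) :
    sgnVec b i * sgnVec b i = 1 := by
  cases hb : b i <;> simp [sgnVec, hb]

theorem sgnVec_beq {d : ℕ} (a b : Fin d → Bool) :
    sgnVec (fun i => a i == b i) = fun i => sgnVec a i * sgnVec b i := by
  funext i
  cases ha : a i <;> cases hb : b i <;> simp [sgnVec, ha, hb]

/-- Coordinatewise multiplication by `sgnVec b`, as a permutation of Boolean vectors. -/
def flipEquiv {d : ℕ} (b : Fin d → Bool) : Equiv.Perm (Fin d → Bool) :=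
  Function.Involutive.toPerm (fun a i => a i == b i) fun a => by
    funext i
    cases ha : a i <;> cases hb : b i <;> simp [ha, hb]

theorem sgnVec_flipEquiv {d : ℕ} (a b : Fin d → Bool) :
    sgnVec (flipEquiv b a) = fun i => sgnVec a i * sgnVec b i :=
  sgnVec_beq a b

/-- A probability distribution on the cube integrates every function as a finite sum. -/
theorem integral_eq_sum_of_cube {d : ℕ} (P : Measure (Fin d → ℝ)) [IsProbabilityMeasure P]
    (hP : P (cube d) = 1) (f : (Fin d → ℝ) → ℝ) :
    ∫ x, f x ∂P = ∑ b : Fin d → Bool, P.real {sgnVec b} * f (sgnVec b) := by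
  classical
  let s : Finset (Fin d → ℝ) := Finset.univ.image sgnVec
  have hs : (s : Set (Fin d → ℝ)) = cube d := by simp [s, range_sgnVec]
  have hr : P.restrict (s : Set (Fin d → ℝ)) = P := by
    refine Measure.restrict_eq_self_of_ae_mem ?_
    rw [hs]
    exact (mem_ae_iff_prob_eq_one (hs ▸ s.measurableSet)).2 hP
  calc
    ∫ x, f x ∂P = ∫ x in (s : Set (Fin d → ℝ)), f x ∂P := by rw [hr]
    _ = ∑ x ∈ s, P.real {x} • f x :=
      setIntegral_finset s IntegrableOn.finset
    _ = _ := by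
      rw [Finset.sum_image fun a _ b _ hab => sgnVec_injective d hab]
      rfl

theorem integral_flipped {d : ℕ} (P : Measure (Fin d → ℝ)) (h : (Fin d → ℝ) → ℝ)
    (a : Fin d → Bool) :
    ∫ x, h x ∂(flipped P (sgnVec a)) = ∫ x, h (fun i => sgnVec a i * x i) ∂P := by
  have hinv : Function.Involutive fun (x : Fin d → ℝ) i => sgnVec a i * x i := by
    intro x
    funext i
    simp only [← mul_assoc, sgnVec_mul_self, one_mul]
  have hm : Measurable fun (x : Fin d → ℝ) i => sgnVec a i * x i := by fun_prop
  let e : (Fin d → ℝ) ≃ᵐ (Fin d → ℝ) := ⟨hinv.toPerm, hm, hm⟩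
  exact integral_map_equiv e h

theorem sum_prod_sgnVec_mul {d : ℕ} (a b : Fin d → Bool) :
    ∑ S : Finset (Fin d), (∏ i ∈ S, sgnVec a i) * ∏ i ∈ S, sgnVec b i =
      if a = b then 2 ^ d else 0 := by
  simp_rw [← Finset.prod_mul_distrib]
  rw [← Finset.powerset_univ, ← Finset.prod_one_add]
  split_ifs with hab
  · subst hab
    norm_num [sgnVec_mul_self]
  · obtain ⟨i, hi⟩ := Function.ne_iff.1 hab
    refine Finset.prod_eq_zero (Finset.mem_univ i) ?_
    cases ha : a i <;> cases hb : b i <;> simp_all [sgnVec]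

/-- Parseval's identity on the Boolean cube. -/
theorem sum_fnFourier_sq {d : ℕ} (h : (Fin d → ℝ) → ℝ) :
    ∑ S : Finset (Fin d), fnFourier h S ^ 2 =
      (1 / 2 ^ d) * ∑ b : Fin d → Bool, h (sgnVec b) ^ 2 := by
  have key : ∑ S : Finset (Fin d), (∑ b : Fin d → Bool, h (sgnVec b) * ∏ i ∈ S, sgnVec b i) ^ 2 =
      2 ^ d * ∑ b : Fin d → Bool, h (sgnVec b) ^ 2 := by
    simp_rw [sq, Finset.sum_mul_sum]
    rw [Finset.sum_comm, Finset.mul_sum]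
    refine Finset.sum_congr rfl fun a _ => ?_
    rw [Finset.sum_comm]
    simp_rw [mul_mul_mul_comm, ← Finset.mul_sum, sum_prod_sgnVec_mul]
    simp [mul_comm]
  simp_rw [fnFourier, mul_pow, ← Finset.mul_sum]
  rw [key]
  field_simp

theorem fnFourier_comp_mul_sgnVec {d : ℕ} (h : (Fin d → ℝ) → ℝ) (b : Fin d → Bool)
    (S : Finset (Fin d)) :
    fnFourier (fun y => h fun i => y i * sgnVec b i) S =
      fnFourier h S * ∏ i ∈ S, sgnVec b i := by
  rw [fnFourier, fnFourier, mul_assoc, Finset.sum_mul]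
  congr 1
  rw [← Equiv.sum_comp (flipEquiv b)]
  refine Finset.sum_congr rfl fun a _ => ?_
  simp only [sgnVec_flipEquiv, Finset.prod_mul_distrib, mul_assoc, sgnVec_mul_self, mul_one]

theorem fnFourier_integral_mul {d : ℕ} (P : Measure (Fin d → ℝ)) [IsProbabilityMeasure P]
    (hP : P (cube d) = 1) (h : (Fin d → ℝ) → ℝ) (S : Finset (Fin d)) :
    fnFourier (fun y => ∫ x, h (fun i => y i * x i) ∂P) S = fnFourier h S * cubeFourier P S := by
  rw [cubeFourier, integral_eq_sum_of_cube P hP, Finset.mul_sum]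
  simp_rw [mul_left_comm (fnFourier h S), ← fnFourier_comp_mul_sgnVec, fnFourier,
    integral_eq_sum_of_cube P hP, Finset.sum_mul, Finset.mul_sum]
  rw [Finset.sum_comm]
  refine Finset.sum_congr rfl fun b _ => Finset.sum_congr rfl fun a _ => ?_
  ring

theorem fnFourier_sub {d : ℕ} (f g : (Fin d → ℝ) → ℝ) (S : Finset (Fin d)) :
    fnFourier (fun y => f y - g y) S = fnFourier f S - fnFourier g S := by
  simp [fnFourier, sub_mul, mul_sub]

theorem sum_fnFourier_sq_le_one {d : ℕ} (h : (Fin d → ℝ) → ℝ) (hh : ∀ x ∈ cube d, |h x| ≤ 1) :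
    ∑ S : Finset (Fin d), fnFourier h S ^ 2 ≤ 1 := by
  rw [sum_fnFourier_sq]
  have hsum : ∑ b : Fin d → Bool, h (sgnVec b) ^ 2 ≤ ∑ _b : Fin d → Bool, (1 : ℝ) :=
    Finset.sum_le_sum fun b _ => (sq_le_one_iff_abs_le_one _).2 (hh _ (sgnVec_mem_cube b))
  calc
    (1 / 2 ^ d : ℝ) * ∑ b : Fin d → Bool, h (sgnVec b) ^ 2
      ≤ (1 / 2 ^ d) * ∑ _b : Fin d → Bool, (1 : ℝ) := by gcongr
    _ = 1 := by simp

/-- For probability distributions `P, Q` on `{-1,1}^d` and `h : {-1,1}^d → [-1,1]`,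
`E_a[(E_{P_a}[h] - E_{Q_a}[h])²] = ∑_S ĥ(S)² (P̂(S) - Q̂(S))²`; in particular, if
`|P̂(S) - Q̂(S)| ≤ θ` for all `S`, this expectation is at most `θ²`. -/
theorem expectation_of_squared_difference (d : ℕ) (P Q : Measure (Fin d → ℝ))
    [IsProbabilityMeasure P] [IsProbabilityMeasure Q]
    (hP : P (cube d) = 1) (hQ : Q (cube d) = 1)
    (h : (Fin d → ℝ) → ℝ) (hh : ∀ x ∈ cube d, |h x| ≤ 1) :
    ((1 / 2 ^ d) * ∑ a : Fin d → Bool,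
        ((∫ x, h x ∂(flipped P (sgnVec a))) - ∫ x, h x ∂(flipped Q (sgnVec a))) ^ 2 =
      ∑ S : Finset (Fin d), fnFourier h S ^ 2 * (cubeFourier P S - cubeFourier Q S) ^ 2) ∧
    ∀ θ : ℝ, (∀ S : Finset (Fin d), |cubeFourier P S - cubeFourier Q S| ≤ θ) →
      (1 / 2 ^ d) * ∑ a : Fin d → Bool,
        ((∫ x, h x ∂(flipped P (sgnVec a))) - ∫ x, h x ∂(flipped Q (sgnVec a))) ^ 2 ≤
        θ ^ 2 := by
  have hmain : (1 / 2 ^ d) * ∑ a : Fin d → Bool,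
        ((∫ x, h x ∂(flipped P (sgnVec a))) - ∫ x, h x ∂(flipped Q (sgnVec a))) ^ 2 =
      ∑ S : Finset (Fin d), fnFourier h S ^ 2 * (cubeFourier P S - cubeFourier Q S) ^ 2 := by
    simp_rw [integral_flipped]
    rw [← sum_fnFourier_sq fun y =>
      (∫ x, h (fun i => y i * x i) ∂P) - ∫ x, h (fun i => y i * x i) ∂Q]
    simp_rw [fnFourier_sub, fnFourier_integral_mul P hP, fnFourier_integral_mul Q hQ, ← mul_sub,
      mul_pow]
  refine ⟨hmain, fun θ hθ => ?_⟩
  rw [hmain]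
  calc
    ∑ S : Finset (Fin d), fnFourier h S ^ 2 * (cubeFourier P S - cubeFourier Q S) ^ 2
      ≤ ∑ S : Finset (Fin d), fnFourier h S ^ 2 * θ ^ 2 := by
        refine Finset.sum_le_sum fun S _ => mul_le_mul_of_nonneg_left ?_ (sq_nonneg _)
        exact sq_le_sq.2 ((hθ S).trans (le_abs_self θ))
    _ = (∑ S : Finset (Fin d), fnFourier h S ^ 2) * θ ^ 2 := by rw [Finset.sum_mul]
    _ ≤ θ ^ 2 := mul_le_of_le_one_left (sq_nonneg θ) (sum_fnFourier_sq_le_one h hh)
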